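/- arXiv:1107.0571 — 4 statements merged into one kernel-verified Lean document; each statement's English description precedes it below -/
import Mathlib

section
/- Let h > 0 satisfy (γ1 + γ2)h < 1 and let μ ∈ [0,1). Then for every b, d ∈ ℝ^d the implicit split-step backward Euler equation c = h·f(c, μ·c + (1−μ)·b) + d has exactly one solution c ∈ ℝ^d. -/
open scoped RealInnerProductSpace

/-- A monotone family of pairs `(x i, g i)` satisfies
`0 ≤ ∑ i, w i * ⟪g i, x i - ∑ j, w j • x j⟫` for all convex weights `w`. -/
theorem sum_mul_inner_sub_convexCombination_nonneg {ι E : Type*} [Fintype ι]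
    [NormedAddCommGroup E] [InnerProductSpace ℝ E] (x g : ι → E)
    (hmono : ∀ i j, 0 ≤ ⟪g i - g j, x i - x j⟫) (w : ι → ℝ) (hw : ∀ i, 0 ≤ w i)
    (hw1 : ∑ i, w i = 1) :
    0 ≤ ∑ i, w i * ⟪g i, x i - ∑ j, w j • x j⟫ := by
  have hexpand : ∑ i, w i * ⟪g i, x i - ∑ j, w j • x j⟫ =
      ∑ i, ∑ j, w i * w j * ⟪g i, x i - x j⟫ := by
    refine Finset.sum_congr rfl fun i _ => ?_
    have hx : x i - ∑ j, w j • x j = ∑ j, w j • (x i - x j) := by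
      simp [smul_sub, Finset.sum_sub_distrib, ← Finset.sum_smul, hw1]
    rw [hx, inner_sum, Finset.mul_sum]
    refine Finset.sum_congr rfl fun j _ => ?_
    rw [real_inner_smul_right, mul_assoc]
  have hsymm : 2 * ∑ i, ∑ j, w i * w j * ⟪g i, x i - x j⟫ =
      ∑ i, ∑ j, w i * w j * ⟪g i - g j, x i - x j⟫ := by
    rw [two_mul]
    nth_rewrite 2 [Finset.sum_comm]
    simp only [← Finset.sum_add_distrib]
    refine Finset.sum_congr rfl fun i _ => Finset.sum_congr rfl fun j _ => ?_
    rw [inner_sub_left, ← neg_sub (x i) (x j), inner_neg_right]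
    ring
  have hnonneg : 0 ≤ ∑ i, ∑ j, w i * w j * ⟪g i - g j, x i - x j⟫ :=
    Finset.sum_nonneg fun i _ => Finset.sum_nonneg fun j _ =>
      mul_nonneg (mul_nonneg (hw i) (hw j)) (hmono i j)
  rw [hexpand]
  linarith

/-- A finite monotone family `(x i, g i)` with all `x i` in a nonempty compact convex set `K`
admits a point `c ∈ K` with `0 ≤ ⟪g i, x i - c⟫` for all `i`. -/
theorem exists_mem_forall_inner_sub_nonneg_of_finite {ι E : Type*} [Fintype ι]
    [NormedAddCommGroup E] [InnerProductSpace ℝ E] {K : Set E} (hK : IsCompact K)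
    (hKc : Convex ℝ K) (hKne : K.Nonempty) (x g : ι → E) (hx : ∀ i, x i ∈ K)
    (hmono : ∀ i j, 0 ≤ ⟪g i - g j, x i - x j⟫) :
    ∃ c ∈ K, ∀ i, 0 ≤ ⟪g i, x i - c⟫ := by
  classical
  by_contra! hcon
  let φ : E → ι → ℝ := fun c i => ⟪g i, x i - c⟫
  have hφ : Continuous φ := by fun_prop
  have hconv : Convex ℝ (φ '' K) := by
    rintro _ ⟨a, ha, rfl⟩ _ ⟨b, hb, rfl⟩ s t hs ht hst
    refine ⟨s • a + t • b, hKc ha hb hs ht hst, ?_⟩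
    funext i
    have hsplit : x i - (s • a + t • b) = s • (x i - a) + t • (x i - b) := by
      rw [smul_sub, smul_sub, ← sub_eq_zero]
      have : x i = s • x i + t • x i := by rw [← add_smul, hst, one_smul]
      nth_rewrite 1 [this]
      abel
    simp only [φ, hsplit, inner_add_right, real_inner_smul_right, Pi.add_apply, Pi.smul_apply,
      smul_eq_mul]
  have hdisj : Disjoint (φ '' K) (Set.Ici 0) := by
    rw [Set.disjoint_left]
    rintro _ ⟨c, hc, rfl⟩ hpos
    obtain ⟨i, hi⟩ := hcon c hc
    exact (hi.trans_le (hpos i)).false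
  obtain ⟨ℓ, u, v, hu, huv, hv⟩ := geometric_hahn_banach_compact_closed hconv (hK.image hφ)
    (convex_Ici 0) isClosed_Ici hdisj
  have hv0 : v < 0 := by simpa using hv 0 (Set.mem_Ici.2 le_rfl)
  let w : ι → ℝ := fun i => ℓ (Pi.single i 1)
  have hℓ : ∀ y : ι → ℝ, ℓ y = ∑ i, w i * y i := fun y => by
    conv_lhs => rw [pi_eq_sum_univ' y]
    simp only [map_sum, map_smul, smul_eq_mul, w]
    refine Finset.sum_congr rfl fun i _ => ?_
    rw [mul_comm]
  have hw : ∀ i, 0 ≤ w i := by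
    intro i
    by_contra! hneg
    have hmem : (v / w i) • (Pi.single i 1 : ι → ℝ) ∈ Set.Ici (0 : ι → ℝ) :=
      Set.mem_Ici.2 <|
        smul_nonneg (div_nonneg_of_nonpos hv0.le hneg.le) (Pi.single_nonneg.2 zero_le_one)
    have := hv _ hmem
    rw [map_smul, smul_eq_mul] at this
    change v < v / w i * w i at this
    rw [div_mul_cancel₀ _ hneg.ne] at this
    exact this.false
  have hlt : ∀ c ∈ K, ∑ i, w i * ⟪g i, x i - c⟫ < 0 := fun c hc => by
    have := hu _ ⟨c, hc, rfl⟩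
    rw [hℓ] at this
    exact this.trans (huv.trans hv0)
  have hsum : 0 < ∑ i, w i := by
    refine (Finset.sum_nonneg fun i _ => hw i).lt_of_ne' fun h0 => ?_
    obtain ⟨c, hc⟩ := hKne
    have hz := (Finset.sum_eq_zero_iff_of_nonneg fun i _ => hw i).1 h0
    have := hlt c hc
    rw [Finset.sum_eq_zero fun i hi => by rw [hz i hi, zero_mul]] at this
    exact this.false
  set s := ∑ i, w i with hs
  have hw1 : ∑ i, w i / s = 1 := by rw [← Finset.sum_div, div_self hsum.ne']
  have hw0 : ∀ i, 0 ≤ w i / s := fun i => div_nonneg (hw i) hsum.le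
  have hnonneg := sum_mul_inner_sub_convexCombination_nonneg x g hmono (fun i => w i / s) hw0 hw1
  have hneg := hlt _ (hKc.sum_mem (fun i _ => hw0 i) hw1 fun i _ => hx i)
  simp only [div_mul_eq_mul_div, ← Finset.sum_div] at hnonneg
  exact (div_neg_of_neg_of_pos hneg hsum).not_ge hnonneg

/-- The variational inequality of a continuous monotone map on a nonempty compact convex set
has a solution. -/
theorem exists_mem_forall_inner_sub_nonneg_of_monotone {E : Type*}
    [NormedAddCommGroup E] [InnerProductSpace ℝ E] {K : Set E} (hK : IsCompact K)
    (hKc : Convex ℝ K) (hKne : K.Nonempty) {G : E → E} (hG : Continuous G)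
    (hmono : ∀ x y, 0 ≤ ⟪G x - G y, x - y⟫) :
    ∃ c ∈ K, ∀ z ∈ K, 0 ≤ ⟪G c, z - c⟫ := by
  obtain ⟨c, hc, hcz⟩ : (K ∩ ⋂ z : K, {c | 0 ≤ ⟪G z, z - c⟫}).Nonempty := by
    refine hK.inter_iInter_nonempty _
      (fun z => isClosed_le continuous_const (by fun_prop)) fun u => ?_
    obtain ⟨c, hc, hcu⟩ := exists_mem_forall_inner_sub_nonneg_of_finite hK hKc hKne
      (fun i : u => (i : E)) (fun i : u => G i) (fun i => i.1.2) fun i j => hmono _ _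
    exact ⟨c, hc, Set.mem_iInter₂.2 fun i hi => hcu ⟨i, hi⟩⟩
  refine ⟨c, hc, fun z hz => ?_⟩
  have hlim : Filter.Tendsto (fun t : ℝ => ⟪G (c + t • (z - c)), z - c⟫) (nhdsWithin 0 (Set.Ioi 0))
      (nhds ⟪G c, z - c⟫) := by
    have hcont : Continuous fun t : ℝ => ⟪G (c + t • (z - c)), z - c⟫ := by fun_prop
    simpa using (hcont.tendsto 0).mono_left nhdsWithin_le_nhds
  refine ge_of_tendsto hlim ?_
  filter_upwards [Ioo_mem_nhdsGT (zero_lt_one (α := ℝ))] with t ht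
  have hmem : c + t • (z - c) ∈ K := hKc.add_smul_sub_mem hc hz ⟨ht.1.le, ht.2.le⟩
  have hineq := Set.mem_iInter.1 hcz ⟨_, hmem⟩
  simp only [Set.mem_ofPred_eq, add_sub_cancel_left, real_inner_smul_right] at hineq
  exact nonneg_of_mul_nonneg_right hineq ht.1

/-- A continuous strongly monotone map on a finite-dimensional real inner product space has
exactly one zero. -/
theorem existsUnique_eq_zero_of_stronglyMonotone {E : Type*}
    [NormedAddCommGroup E] [InnerProductSpace ℝ E] [FiniteDimensional ℝ E] {G : E → E}
    (hG : Continuous G) {m : ℝ} (hm : 0 < m)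
    (hmono : ∀ x y, m * ‖x - y‖ ^ 2 ≤ ⟪G x - G y, x - y⟫) :
    ∃! c, G c = 0 := by
  refine existsUnique_of_exists_of_unique ?_ fun x y hx hy => ?_
  · have := FiniteDimensional.proper_real E
    set R := ‖G 0‖ / m + 1 with hR
    have hRpos : 0 < R := by positivity
    obtain ⟨c, -, hcz⟩ := exists_mem_forall_inner_sub_nonneg_of_monotone
      (isCompact_closedBall (0 : E) R) (convex_closedBall 0 R) ⟨0, by simpa using hRpos.le⟩ hG
      fun x y => (by positivity : 0 ≤ m * ‖x - y‖ ^ 2).trans (hmono x y)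
    have hcR : ‖c‖ < R := by
      have h0 := hcz 0 (by simpa using hRpos.le)
      have h1 := hmono c 0
      have h2 := neg_le_of_abs_le (abs_real_inner_le_norm (G 0) c)
      simp only [zero_sub, inner_neg_right] at h0
      simp only [sub_zero, inner_sub_left] at h1
      have h3 : m * ‖c‖ ^ 2 ≤ ‖G 0‖ * ‖c‖ := by linarith
      have h4 : ‖c‖ ≤ ‖G 0‖ / m := by
        rcases (norm_nonneg c).eq_or_lt with hc0 | hc0
        · rw [← hc0]
          positivity
        · rw [le_div_iff₀ hm]
          nlinarith
      linarith
    refine ⟨c, ?_⟩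
    have hcont : Continuous fun t : ℝ => c - t • G c := by fun_prop
    have hev : ∀ᶠ t in nhdsWithin (0 : ℝ) (Set.Ioi 0), ‖c - t • G c‖ < R :=
      nhdsWithin_le_nhds (hcont.norm.continuousAt.eventually_lt continuousAt_const
        (by simpa using hcR))
    obtain ⟨t, ht, ht0⟩ := (hev.and self_mem_nhdsWithin).exists
    have hineq := hcz (c - t • G c) (by simpa using ht.le)
    rw [sub_sub_cancel_left, inner_neg_right, real_inner_smul_right, real_inner_self_eq_norm_sq]
      at hineq
    have hsq : ‖G c‖ ^ 2 ≤ 0 := by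
      have ht0' : 0 < t := ht0
      by_contra! hpos
      have := mul_pos ht0' hpos
      linarith
    exact norm_eq_zero.1 (pow_eq_zero_iff two_ne_zero |>.1 (hsq.antisymm (sq_nonneg _)))
  · have hxy := hmono x y
    rw [hx, hy, sub_self, inner_zero_left] at hxy
    have hsq : ‖x - y‖ ^ 2 = 0 := by
      refine le_antisymm ?_ (sq_nonneg _)
      by_contra! hpos
      have := mul_pos hm hpos
      linarith
    exact sub_eq_zero.1 (norm_eq_zero.1 (pow_eq_zero_iff two_ne_zero |>.1 hsq))

/-- Under the one-sided Lipschitz condition (constant `γ1`) in the first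
argument and the global Lipschitz condition (constant `γ2 ≥ 0`) in the second argument for
the continuous drift `f`, if `(γ1 + γ2) h < 1` and `μ ∈ [0,1)`, then for every `b, d ∈ ℝ^d`
the implicit split-step backward Euler equation `c = h f(c, μ c + (1-μ) b) + d` has exactly
one solution `c`. -/
theorem ssbe_implicit_equation_unique_solution
    {d : ℕ} (hd : 0 < d)
    (f : EuclideanSpace ℝ (Fin d) → EuclideanSpace ℝ (Fin d) → EuclideanSpace ℝ (Fin d))
    (hfc : Continuous (fun p : EuclideanSpace ℝ (Fin d) × EuclideanSpace ℝ (Fin d) =>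
      f p.1 p.2))
    (γ1 γ2 : ℝ) (hγ2 : 0 ≤ γ2)
    (hols : ∀ x1 x2 y : EuclideanSpace ℝ (Fin d),
      ⟪x2 - x1, f x2 y - f x1 y⟫ ≤ γ1 * ‖x2 - x1‖ ^ 2)
    (hlip : ∀ x y1 y2 : EuclideanSpace ℝ (Fin d),
      ‖f x y2 - f x y1‖ ≤ γ2 * ‖y2 - y1‖)
    (h : ℝ) (hh : 0 < h) (hcond : (γ1 + γ2) * h < 1)
    (μ : ℝ) (hμ0 : 0 ≤ μ) (hμ1 : μ < 1) :
    ∀ b dd : EuclideanSpace ℝ (Fin d),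
      ∃! c : EuclideanSpace ℝ (Fin d), c = h • f c (μ • c + (1 - μ) • b) + dd := by
  intro b dd
  have hm : 0 < 1 - (γ1 + γ2) * h := by linarith
  have hGc : Continuous fun c => c - (h • f c (μ • c + (1 - μ) • b) + dd) := by
    have hcomp : Continuous fun c => f c (μ • c + (1 - μ) • b) :=
      hfc.comp (continuous_id.prodMk (by fun_prop))
    fun_prop
  have hmono : ∀ x y, (1 - (γ1 + γ2) * h) * ‖x - y‖ ^ 2 ≤
      ⟪(x - (h • f x (μ • x + (1 - μ) • b) + dd)) - (y - (h • f y (μ • y + (1 - μ) • b) + dd)),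
        x - y⟫ := by
    intro x y
    set p := μ • x + (1 - μ) • b with hp
    set q := μ • y + (1 - μ) • b with hq
    have hpq : ‖p - q‖ ≤ ‖x - y‖ := by
      rw [hp, hq, add_sub_add_right_eq_sub, ← smul_sub, norm_smul, Real.norm_of_nonneg hμ0]
      exact mul_le_of_le_one_left (norm_nonneg _) hμ1.le
    have hfirst := hols y x p
    have hsecond : ⟪x - y, f y p - f y q⟫ ≤ γ2 * ‖x - y‖ ^ 2 := calc
      ⟪x - y, f y p - f y q⟫ ≤ ‖x - y‖ * ‖f y p - f y q‖ := real_inner_le_norm _ _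
      _ ≤ ‖x - y‖ * (γ2 * ‖x - y‖) := by
        gcongr
        exact (hlip y q p).trans (by gcongr)
      _ = γ2 * ‖x - y‖ ^ 2 := by ring
    have hsplit : (x - (h • f x p + dd)) - (y - (h • f y q + dd)) =
        (x - y) - h • ((f x p - f y p) + (f y p - f y q)) := by
      rw [sub_add_sub_cancel, smul_sub]
      abel
    rw [hsplit, inner_sub_left, real_inner_self_eq_norm_sq, real_inner_smul_left,
      real_inner_comm, inner_add_right]
    have := mul_le_mul_of_nonneg_left (add_le_add hfirst hsecond) hh.le
    linarith
  simpa only [sub_eq_zero] using existsUnique_eq_zero_of_stronglyMonotone hGc hm hmono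
end

section
/- Let h > 0 and suppose c1, c2, d1, d2, e1, e2 ∈ ℝ^d satisfy the implicit relations c_i = d_i + h·f(c_i, e_i) for i = 1, 2. Then (1 − 2hγ1 − hγ2)·|c1−c2|² ≤ |d1−d2|² + hγ2·|e1−e2|². -/
open scoped RealInnerProductSpace

/-- If `f` is one-sided Lipschitz (constant `γ1`) in its first argument and
globally Lipschitz (constant `γ2 ≥ 0`) in its second argument, `h > 0`, and
`c_i = d_i + h f(c_i, e_i)` for `i = 1, 2`, then
`(1 - 2hγ1 - hγ2) |c1-c2|² ≤ |d1-d2|² + hγ2 |e1-e2|²`. -/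
theorem ssbe_implicit_stage_contractivity
    {d : ℕ} (hd : 0 < d)
    (f : EuclideanSpace ℝ (Fin d) → EuclideanSpace ℝ (Fin d) → EuclideanSpace ℝ (Fin d))
    (γ1 γ2 : ℝ) (hγ2 : 0 ≤ γ2)
    (hols : ∀ x1 x2 y : EuclideanSpace ℝ (Fin d),
      ⟪x2 - x1, f x2 y - f x1 y⟫ ≤ γ1 * ‖x2 - x1‖ ^ 2)
    (hlip : ∀ x y1 y2 : EuclideanSpace ℝ (Fin d),
      ‖f x y2 - f x y1‖ ≤ γ2 * ‖y2 - y1‖)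
    (h : ℝ) (hh : 0 < h)
    (c1 c2 d1 d2 e1 e2 : EuclideanSpace ℝ (Fin d))
    (hc1 : c1 = d1 + h • f c1 e1) (hc2 : c2 = d2 + h • f c2 e2) :
    (1 - 2 * h * γ1 - h * γ2) * ‖c1 - c2‖ ^ 2 ≤
      ‖d1 - d2‖ ^ 2 + h * γ2 * ‖e1 - e2‖ ^ 2 := by
  have hD : d1 - d2 = (c1 - c2) - h • (f c1 e1 - f c2 e2) := by
    rw [eq_sub_of_add_eq hc1.symm, eq_sub_of_add_eq hc2.symm, smul_sub]
    abel
  have hsplit : ⟪c1 - c2, f c1 e1 - f c2 e2⟫ =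
      ⟪c1 - c2, f c1 e1 - f c2 e1⟫ + ⟪c1 - c2, f c2 e1 - f c2 e2⟫ := by
    rw [← inner_add_right, sub_add_sub_cancel]
  have hcross : ⟪c1 - c2, f c2 e1 - f c2 e2⟫ ≤ ‖c1 - c2‖ * (γ2 * ‖e1 - e2‖) :=
    (real_inner_le_norm _ _).trans
      (mul_le_mul_of_nonneg_left (hlip c2 e2 e1) (norm_nonneg _))
  have hinner : ⟪c1 - c2, f c1 e1 - f c2 e2⟫ ≤
      γ1 * ‖c1 - c2‖ ^ 2 + ‖c1 - c2‖ * (γ2 * ‖e1 - e2‖) := by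
    linarith [hols c2 c1 e1]
  have hscaled := mul_le_mul_of_nonneg_left hinner hh.le
  have hyoung := mul_nonneg (mul_nonneg hh.le hγ2) (sq_nonneg (‖c1 - c2‖ - ‖e1 - e2‖))
  rw [hD, norm_sub_sq_real (c1 - c2), real_inner_smul_right]
  linarith [sq_nonneg ‖h • (f c1 e1 - f c2 e2)‖]
end

section
/- Let κ ≥ 1 be an integer, β ∈ (0,1), A ≥ 0, and let u : ℕ → ℝ be a nonnegative sequence with u_0 ≤ A such that for every n ≥ 1, u_n ≤ β · max{ u_i : max(n−κ−1, 0) ≤ i ≤ n−1 }. Then for every n ≥ 1, u_n ≤ β^{⌊(n−1)/(κ+1)⌋ + 1} · A; in particular u_n ≤ β^{(n−1)/(κ+1)} · A and u_n → 0 as n → ∞. -/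
/-- discrete Halanay-type inequality. Let `κ ≥ 1`, `β ∈ (0,1)`, `A ≥ 0`,
and let `u : ℕ → ℝ` be nonnegative with `u 0 ≤ A` and, for every `n ≥ 1`,
`u n ≤ β * max { u i : max (n - κ - 1) 0 ≤ i ≤ n - 1 }`. Then for every `n ≥ 1`,
`u n ≤ β ^ (⌊(n-1)/(κ+1)⌋ + 1) * A`; in particular `u n ≤ β ^ ((n-1)/(κ+1) : ℝ) * A`
(real exponent) and `u n → 0` as `n → ∞`. -/
theorem discrete_halanay_geometric_decay
    (κ : ℕ) (hκ : 1 ≤ κ) (β A : ℝ) (hβ0 : 0 < β) (hβ1 : β < 1) (hA : 0 ≤ A)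
    (u : ℕ → ℝ) (hu : ∀ n, 0 ≤ u n) (hu0 : u 0 ≤ A)
    (hrec : ∀ n, 1 ≤ n →
      u n ≤ β * (Finset.Icc (n - (κ + 1)) (n - 1)).sup'
        (Finset.nonempty_Icc.mpr (by omega)) u) :
    (∀ n, 1 ≤ n → u n ≤ β ^ ((n - 1) / (κ + 1) + 1) * A) ∧
    (∀ n, 1 ≤ n → u n ≤ β ^ ((((n : ℝ) - 1)) / ((κ : ℝ) + 1)) * A) ∧
    Filter.Tendsto u Filter.atTop (nhds 0) := by
  have decay : ∀ n, 1 ≤ n → u n ≤ β ^ ((n - 1) / (κ + 1) + 1) * A := by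
    intro n
    induction n using Nat.strong_induction_on with
    | _ n ih =>
      intro hn
      refine (hrec n hn).trans ?_
      rw [pow_succ', mul_assoc]
      refine mul_le_mul_of_nonneg_left (Finset.sup'_le _ _ fun i hi => ?_) hβ0.le
      obtain ⟨hi₁, hi₂⟩ := Finset.mem_Icc.mp hi
      rcases Nat.eq_zero_or_pos i with rfl | hpos
      · rw [Nat.div_eq_of_lt (by omega), pow_zero, one_mul]
        exact hu0
      · refine (ih i (by omega) hpos).trans (mul_le_mul_of_nonneg_right ?_ hA)
        refine pow_le_pow_of_le_one hβ0.le hβ1.le ?_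
        rw [← Nat.add_div_right _ (Nat.succ_pos κ)]
        exact Nat.div_le_div_right (by omega)
  have decay_rpow : ∀ n, 1 ≤ n → u n ≤ β ^ ((((n : ℝ) - 1)) / ((κ : ℝ) + 1)) * A := by
    intro n hn
    refine (decay n hn).trans (mul_le_mul_of_nonneg_right ?_ hA)
    rw [← Real.rpow_natCast]
    refine Real.rpow_le_rpow_of_exponent_ge hβ0 hβ1.le ?_
    rw [div_le_iff₀ (by positivity), sub_le_iff_le_add]
    have h := Nat.lt_div_mul_add (a := n - 1) (Nat.succ_pos κ)
    have h' : n ≤ ((n - 1) / (κ + 1) + 1) * (κ + 1) + 1 := by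
      rw [add_one_mul]
      simp only [Nat.succ_eq_add_one] at h
      omega
    exact_mod_cast h'
  refine ⟨decay, decay_rpow, ?_⟩
  have exponent : Filter.Tendsto (fun n : ℕ => ((n : ℝ) - 1) / ((κ : ℝ) + 1))
      Filter.atTop Filter.atTop :=
    (Filter.tendsto_atTop_add_const_right _ (-1) tendsto_natCast_atTop_atTop).atTop_div_const
      (by positivity)
  have bound := ((tendsto_rpow_atTop_of_base_lt_one β (by linarith) hβ1).comp exponent).mul_const A
  rw [zero_mul] at bound
  exact squeeze_zero' (Filter.Eventually.of_forall hu)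
    (Filter.eventually_atTop.mpr ⟨1, decay_rpow⟩) bound
end

section
/- Suppose in addition that γ1 + γ2 ≤ 0. Let h > 0, M ≥ 0, and suppose c1, c2, d1, d2, e1, e2 ∈ ℝ^d satisfy c_i = d_i + h·f(c_i, e_i) for i = 1, 2, with |d1−d2| ≤ M and |e1−e2| ≤ M. Then |c1−c2| ≤ M. -/
open scoped RealInnerProductSpace

/-- If `f` is one-sided Lipschitz (constant `γ1`) in its first argument and
globally Lipschitz (constant `γ2 ≥ 0`) in its second argument with `γ1 + γ2 ≤ 0`, `h > 0`,
`c_i = d_i + h f(c_i, e_i)` for `i = 1, 2`, `|d1-d2| ≤ M` and `|e1-e2| ≤ M` with `M ≥ 0`,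
then `|c1-c2| ≤ M`. -/
theorem ssbe_implicit_stage_nonexpansive
    {d : ℕ} (hd : 0 < d)
    (f : EuclideanSpace ℝ (Fin d) → EuclideanSpace ℝ (Fin d) → EuclideanSpace ℝ (Fin d))
    (γ1 γ2 : ℝ) (hγ2 : 0 ≤ γ2)
    (hols : ∀ x1 x2 y : EuclideanSpace ℝ (Fin d),
      ⟪x2 - x1, f x2 y - f x1 y⟫ ≤ γ1 * ‖x2 - x1‖ ^ 2)
    (hlip : ∀ x y1 y2 : EuclideanSpace ℝ (Fin d),
      ‖f x y2 - f x y1‖ ≤ γ2 * ‖y2 - y1‖)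
    (hneg : γ1 + γ2 ≤ 0)
    (h : ℝ) (hh : 0 < h) (M : ℝ) (hM : 0 ≤ M)
    (c1 c2 d1 d2 e1 e2 : EuclideanSpace ℝ (Fin d))
    (hc1 : c1 = d1 + h • f c1 e1) (hc2 : c2 = d2 + h • f c2 e2)
    (hd12 : ‖d1 - d2‖ ≤ M) (he12 : ‖e1 - e2‖ ≤ M) :
    ‖c1 - c2‖ ≤ M := by
  have hdecomp : c1 - c2 = (d1 - d2) + h • (f c1 e1 - f c2 e1) + h • (f c2 e1 - f c2 e2) := by
    conv_lhs => rw [hc1, hc2]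
    module
  have hstage : ‖c1 - c2‖ ^ 2 = ⟪c1 - c2, d1 - d2⟫ + h * ⟪c1 - c2, f c1 e1 - f c2 e1⟫
      + h * ⟪c1 - c2, f c2 e1 - f c2 e2⟫ := by
    rw [← real_inner_self_eq_norm_sq]
    conv_lhs => arg 3; rw [hdecomp]
    rw [inner_add_right, inner_add_right, real_inner_smul_right, real_inner_smul_right]
  have hd_inner : ⟪c1 - c2, d1 - d2⟫ ≤ ‖c1 - c2‖ * M :=
    (real_inner_le_norm _ _).trans (by gcongr)
  have he_inner : ⟪c1 - c2, f c2 e1 - f c2 e2⟫ ≤ ‖c1 - c2‖ * (γ2 * M) :=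
    (real_inner_le_norm _ _).trans (by gcongr; exact (hlip _ _ _).trans (by gcongr))
  have hc_inner : ⟪c1 - c2, f c1 e1 - f c2 e1⟫ ≤ -γ2 * ‖c1 - c2‖ ^ 2 :=
    (hols c2 c1 e1).trans (by gcongr; linarith)
  have hquad : ‖c1 - c2‖ * ((1 + h * γ2) * (‖c1 - c2‖ - M)) ≤ 0 := by
    linarith [mul_le_mul_of_nonneg_left he_inner hh.le, mul_le_mul_of_nonneg_left hc_inner hh.le]
  by_contra! hlt
  have : 0 < ‖c1 - c2‖ * ((1 + h * γ2) * (‖c1 - c2‖ - M)) :=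
    mul_pos (hM.trans_lt hlt) (mul_pos (by positivity) (sub_pos.mpr hlt))
  linarith
end
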